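/- arXiv:1104.4779 — 2 statements merged into one kernel-verified Lean document; each statement's English description precedes it below -/
import Mathlib

section
/- Let A=(A;R1,R2,R3,R4) be an instance and let G be its D-graph. If G retracts to the reflexive 4-cycle H on its distinguished vertices h0,h1,h2,h3, then there exists a homomorphism from A to D, i.e. a map f : A → {0,1,3} such that (f(p),f(q))∈S_i whenever (p,q)∈R_i for i=1,2,3,4. -/
namespace Paper

/-- The relation `S1 = {(0,3),(1,1),(3,1),(3,3)}`. -/
def S1 : Set (ℕ × ℕ) := {(0, 3), (1, 1), (3, 1), (3, 3)}

/-- The relation `S2 = {(1,0),(1,1),(3,1),(3,3)}`. -/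
def S2 : Set (ℕ × ℕ) := {(1, 0), (1, 1), (3, 1), (3, 3)}

/-- The relation `S3 = {(1,3),(3,1),(3,3)}`. -/
def S3 : Set (ℕ × ℕ) := {(1, 3), (3, 1), (3, 3)}

/-- The relation `S4 = {(1,1),(1,3),(3,1)}`. -/
def S4 : Set (ℕ × ℕ) := {(1, 1), (1, 3), (3, 1)}

/-- The domain `{0,1,3}` of the structure `D`. -/
def Dom : Set ℕ := {0, 1, 3}

/-- An instance: four binary relations on a set `α` such that every element
occurs in at least one pair of `R1 ∪ R2 ∪ R3 ∪ R4`. -/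
structure Inst (α : Type) : Type where
  R1 : Set (α × α)
  R2 : Set (α × α)
  R3 : Set (α × α)
  R4 : Set (α × α)
  cover : ∀ a : α, (∃ b, (a, b) ∈ R1 ∪ R2 ∪ R3 ∪ R4) ∨
    (∃ b, (b, a) ∈ R1 ∪ R2 ∪ R3 ∪ R4)

variable {α : Type}

/-- The set `L` of elements occurring as a first coordinate. -/
def Inst.L (I : Inst α) : Set α :=
  {p | ∃ q, (p, q) ∈ I.R1 ∪ I.R2 ∪ I.R3 ∪ I.R4}

/-- The set `R` of elements occurring as a second coordinate. -/
def Inst.Rs (I : Inst α) : Set α :=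
  {q | ∃ p, (p, q) ∈ I.R1 ∪ I.R2 ∪ I.R3 ∪ I.R4}

/-- The non-`H` vertices of the D-graph: the elements of `A`, the vertices
`a_p, b_p` for `p ∈ L` and the vertices `c_q, d_q` for `q ∈ R`. -/
abbrev Core (I : Inst α) : Type := α ⊕ ↥I.L ⊕ ↥I.L ⊕ ↥I.Rs ⊕ ↥I.Rs

/-- The vertex set of the D-graph: `h0,h1,h2,h3` (indexed by `ZMod 4`)
together with the non-`H` vertices. -/
abbrev DVert (I : Inst α) : Type := ZMod 4 ⊕ Core I

def ce (I : Inst α) (a : α) : Core I := Sum.inl a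
def ca (I : Inst α) (p : ↥I.L) : Core I := Sum.inr (Sum.inl p)
def cb (I : Inst α) (p : ↥I.L) : Core I := Sum.inr (Sum.inr (Sum.inl p))
def cc (I : Inst α) (q : ↥I.Rs) : Core I := Sum.inr (Sum.inr (Sum.inr (Sum.inl q)))
def cd (I : Inst α) (q : ↥I.Rs) : Core I := Sum.inr (Sum.inr (Sum.inr (Sum.inr q)))

/-- The vertex `h_i`. -/
def hv (I : Inst α) (i : ZMod 4) : DVert I := Sum.inl i
/-- The vertex corresponding to an element `a ∈ A`. -/
def ev (I : Inst α) (a : α) : DVert I := Sum.inr (ce I a)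
/-- The vertex `a_p` for `p ∈ L`. -/
def av (I : Inst α) (p : ↥I.L) : DVert I := Sum.inr (ca I p)
/-- The vertex `b_p` for `p ∈ L`. -/
def bv (I : Inst α) (p : ↥I.L) : DVert I := Sum.inr (cb I p)
/-- The vertex `c_q` for `q ∈ R`. -/
def cv (I : Inst α) (q : ↥I.Rs) : DVert I := Sum.inr (cc I q)
/-- The vertex `d_q` for `q ∈ R`. -/
def dv (I : Inst α) (q : ↥I.Rs) : DVert I := Sum.inr (cd I q)

/-- The (directed) list of edges of the D-graph. -/
def dBase (I : Inst α) : DVert I → DVert I → Prop := fun u v =>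
  (∃ i : ZMod 4, u = hv I i ∧ v = hv I (i + 1)) ∨
  (∃ p : ↥I.L,
    (u = av I p ∧ v = ev I ↑p) ∨ (u = bv I p ∧ v = ev I ↑p) ∨
    (u = av I p ∧ v = bv I p) ∨ (u = av I p ∧ v = hv I 0) ∨
    (u = av I p ∧ v = hv I 3) ∨ (u = bv I p ∧ v = hv I 1) ∨
    (u = bv I p ∧ v = hv I 2)) ∨
  (∃ q : ↥I.Rs,
    (u = cv I q ∧ v = ev I ↑q) ∨ (u = dv I q ∧ v = ev I ↑q) ∨
    (u = cv I q ∧ v = dv I q) ∨ (u = cv I q ∧ v = hv I 2) ∨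
    (u = cv I q ∧ v = hv I 3) ∨ (u = dv I q ∧ v = hv I 0) ∨
    (u = dv I q ∧ v = hv I 1)) ∨
  (∃ a : α, u = hv I 0 ∧ v = ev I a) ∨
  (∃ p q, (p, q) ∈ I.R1 ∧ ∃ hq : q ∈ I.Rs,
    ((u = cv I ⟨q, hq⟩ ∧ v = ev I p) ∨ (u = ev I q ∧ v = hv I 2))) ∨
  (∃ p q, (p, q) ∈ I.R2 ∧ ∃ hp : p ∈ I.L,
    ((u = ev I p ∧ v = hv I 2) ∨ (u = bv I ⟨p, hp⟩ ∧ v = ev I q))) ∨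
  (∃ p q, (p, q) ∈ I.R3 ∧ ∃ hp : p ∈ I.L, ∃ hq : q ∈ I.Rs,
    ((u = ev I p ∧ v = hv I 2) ∨ (u = ev I q ∧ v = hv I 2) ∨
     (u = av I ⟨p, hp⟩ ∧ v = cv I ⟨q, hq⟩))) ∨
  (∃ p q, (p, q) ∈ I.R4 ∧ ∃ hp : p ∈ I.L, ∃ hq : q ∈ I.Rs,
    ((u = ev I p ∧ v = hv I 2) ∨ (u = ev I q ∧ v = hv I 2) ∨
     (u = bv I ⟨p, hp⟩ ∧ v = dv I ⟨q, hq⟩))) ∨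
  (∃ p p' : ↥I.L, p ≠ p' ∧
    ((u = av I p ∧ v = av I p') ∨ (u = bv I p ∧ v = bv I p'))) ∨
  (∃ q q' : ↥I.Rs, q ≠ q' ∧
    ((u = cv I q ∧ v = cv I q') ∨ (u = dv I q ∧ v = dv I q')))

/-- The D-graph of an instance: the simple graph whose edges are exactly
the (symmetrised) pairs listed in `dBase`. -/
def DGraph (I : Inst α) : SimpleGraph (DVert I) := SimpleGraph.fromRel (dBase I)

/-- Adjacency in the reflexive 4-cycle `H` between *distinct* vertices
(`h_i h_{i+1}` cycle edges), vertices indexed by `ZMod 4`. -/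
def C4adj (x y : ZMod 4) : Prop := y = x + 1 ∨ x = y + 1

/-- A homomorphism from a simple graph `G` to the reflexive 4-cycle `H`:
every edge is mapped to a self-loop or to a cycle edge of `H`. -/
def IsHomC4 {V : Type} (G : SimpleGraph V) (f : V → ZMod 4) : Prop :=
  ∀ u v : V, G.Adj u v → f u = f v ∨ C4adj (f u) (f v)

/-- A retraction from the D-graph to `H`: a homomorphism fixing `h0,…,h3`. -/
def DRetr (I : Inst α) (g : DVert I → ZMod 4) : Prop :=
  IsHomC4 (DGraph I) g ∧ ∀ i : ZMod 4, g (hv I i) = i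

/-- A homomorphism from the instance `I` to the structure `D`. -/
def InstHom (I : Inst α) (f : α → ℕ) : Prop :=
  (∀ a : α, f a ∈ Dom) ∧
  (∀ p q, (p, q) ∈ I.R1 → (f p, f q) ∈ S1) ∧
  (∀ p q, (p, q) ∈ I.R2 → (f p, f q) ∈ S2) ∧
  (∀ p q, (p, q) ∈ I.R3 → (f p, f q) ∈ S3) ∧
  (∀ p q, (p, q) ∈ I.R4 → (f p, f q) ∈ S4)

/-- Equality or adjacency in the reflexive 4-cycle. -/
def ReflC4 (x y : ZMod 4) : Prop := x = y ∨ C4adj x y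

instance : DecidableRel ReflC4 := fun x y => by
  unfold ReflC4 C4adj; infer_instance

lemma DRetr.reflC4 {I : Inst α} {g : DVert I → ZMod 4} (hg : DRetr I g) {u v : DVert I}
    (h : dBase I u v) : ReflC4 (g u) (g v) := by
  by_cases huv : u = v
  · exact Or.inl (congrArg g huv)
  · exact hg.1 u v ((SimpleGraph.fromRel_adj _ _ _).2 ⟨huv, Or.inl h⟩)

/-- The possible values of a retraction at `p`, `a_p`, `b_p` for `p ∈ L`. -/
def LeftType (x a b : ZMod 4) : Prop :=
  (a = 0 ∧ b = 1 ∧ (x = 0 ∨ x = 1)) ∨ (a = 3 ∧ b = 2 ∧ x = 3)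

/-- The possible values of a retraction at `q`, `c_q`, `d_q` for `q ∈ R`. -/
def RightType (x c d : ZMod 4) : Prop :=
  (c = 2 ∧ d = 1 ∧ x = 1) ∨ (c = 3 ∧ d = 0 ∧ (x = 0 ∨ x = 3))

instance (x a b : ZMod 4) : Decidable (LeftType x a b) := by
  unfold LeftType; infer_instance

instance (x c d : ZMod 4) : Decidable (RightType x c d) := by
  unfold RightType; infer_instance

lemma leftType_of_reflC4 : ∀ x a b : ZMod 4, ReflC4 0 x → ReflC4 a x → ReflC4 b x →
    ReflC4 a b → ReflC4 a 0 → ReflC4 a 3 → ReflC4 b 1 → ReflC4 b 2 → LeftType x a b := by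
  intro x a b hx ha hb hab h₀ h₃ h₁ h₂
  have ha' : a = 0 ∨ a = 3 := by clear ha hab; decide +revert
  have hb' : b = 1 ∨ b = 2 := by clear hb hab; decide +revert
  rcases ha' with rfl | rfl <;> rcases hb' with rfl | rfl <;> revert x <;> revert hab <;> decide

lemma rightType_of_reflC4 : ∀ x c d : ZMod 4, ReflC4 0 x → ReflC4 c x → ReflC4 d x →
    ReflC4 c d → ReflC4 c 2 → ReflC4 c 3 → ReflC4 d 0 → ReflC4 d 1 → RightType x c d := by
  intro x c d hx hc hd hcd h₂ h₃ h₀ h₁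
  have hc' : c = 2 ∨ c = 3 := by clear hc hcd; decide +revert
  have hd' : d = 0 ∨ d = 1 := by clear hd hcd; decide +revert
  rcases hc' with rfl | rfl <;> rcases hd' with rfl | rfl <;> revert x <;> revert hcd <;> decide

lemma DRetr.reflC4_zero_ev {I : Inst α} {g : DVert I → ZMod 4} (hg : DRetr I g) (a : α) :
    ReflC4 0 (g (ev I a)) := by
  have h := hg.reflC4 (u := hv I 0) (v := ev I a)
    (Or.inr <| Or.inr <| Or.inr <| Or.inl ⟨a, rfl, rfl⟩)
  rwa [hg.2] at h

lemma DRetr.leftType {I : Inst α} {g : DVert I → ZMod 4} (hg : DRetr I g) (p : I.L) :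
    LeftType (g (ev I p)) (g (av I p)) (g (bv I p)) := by
  have edge {u v : DVert I} (h : (u = av I p ∧ v = ev I ↑p) ∨ (u = bv I p ∧ v = ev I ↑p) ∨
      (u = av I p ∧ v = bv I p) ∨ (u = av I p ∧ v = hv I 0) ∨
      (u = av I p ∧ v = hv I 3) ∨ (u = bv I p ∧ v = hv I 1) ∨
      (u = bv I p ∧ v = hv I 2)) : ReflC4 (g u) (g v) :=
    hg.reflC4 (Or.inr <| Or.inl ⟨p, h⟩)
  have h0 := edge (u := av I p) (v := hv I 0) (by simp)
  have h3 := edge (u := av I p) (v := hv I 3) (by simp)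
  have h1 := edge (u := bv I p) (v := hv I 1) (by simp)
  have h2 := edge (u := bv I p) (v := hv I 2) (by simp)
  rw [hg.2] at h0 h1 h2 h3
  exact leftType_of_reflC4 _ _ _ (hg.reflC4_zero_ev _) (edge (by simp)) (edge (by simp))
    (edge (by simp)) h0 h3 h1 h2

lemma DRetr.rightType {I : Inst α} {g : DVert I → ZMod 4} (hg : DRetr I g) (q : I.Rs) :
    RightType (g (ev I q)) (g (cv I q)) (g (dv I q)) := by
  have edge {u v : DVert I} (h : (u = cv I q ∧ v = ev I ↑q) ∨ (u = dv I q ∧ v = ev I ↑q) ∨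
      (u = cv I q ∧ v = dv I q) ∨ (u = cv I q ∧ v = hv I 2) ∨
      (u = cv I q ∧ v = hv I 3) ∨ (u = dv I q ∧ v = hv I 0) ∨
      (u = dv I q ∧ v = hv I 1)) : ReflC4 (g u) (g v) :=
    hg.reflC4 (Or.inr <| Or.inr <| Or.inl ⟨q, h⟩)
  have h2 := edge (u := cv I q) (v := hv I 2) (by simp)
  have h3 := edge (u := cv I q) (v := hv I 3) (by simp)
  have h0 := edge (u := dv I q) (v := hv I 0) (by simp)
  have h1 := edge (u := dv I q) (v := hv I 1) (by simp)
  rw [hg.2] at h0 h1 h2 h3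
  exact rightType_of_reflC4 _ _ _ (hg.reflC4_zero_ev _) (edge (by simp)) (edge (by simp))
    (edge (by simp)) h2 h3 h0 h1

lemma val_mem_Dom : ∀ x : ZMod 4, ReflC4 0 x → x.val ∈ Dom := by
  simp only [Dom, Set.mem_insert_iff, Set.mem_singleton_iff]
  decide

lemma val_mem_S1 : ∀ x a b y c d : ZMod 4, LeftType x a b → RightType y c d →
    ReflC4 c x → ReflC4 y 2 → (x.val, y.val) ∈ S1 := by
  simp only [LeftType, RightType, S1, Set.mem_insert_iff, Set.mem_singleton_iff, Prod.mk.injEq]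
  rintro x a b y c d (⟨rfl, rfl, rfl | rfl⟩ | ⟨rfl, rfl, rfl⟩)
    (⟨rfl, rfl, rfl⟩ | ⟨rfl, rfl, rfl | rfl⟩) <;> decide

lemma val_mem_S2 : ∀ x a b y c d : ZMod 4, LeftType x a b → RightType y c d →
    ReflC4 x 2 → ReflC4 b y → (x.val, y.val) ∈ S2 := by
  simp only [LeftType, RightType, S2, Set.mem_insert_iff, Set.mem_singleton_iff, Prod.mk.injEq]
  rintro x a b y c d (⟨rfl, rfl, rfl | rfl⟩ | ⟨rfl, rfl, rfl⟩)
    (⟨rfl, rfl, rfl⟩ | ⟨rfl, rfl, rfl | rfl⟩) <;> decide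

lemma val_mem_S3 : ∀ x a b y c d : ZMod 4, LeftType x a b → RightType y c d →
    ReflC4 x 2 → ReflC4 y 2 → ReflC4 a c → (x.val, y.val) ∈ S3 := by
  simp only [LeftType, RightType, S3, Set.mem_insert_iff, Set.mem_singleton_iff, Prod.mk.injEq]
  rintro x a b y c d (⟨rfl, rfl, rfl | rfl⟩ | ⟨rfl, rfl, rfl⟩)
    (⟨rfl, rfl, rfl⟩ | ⟨rfl, rfl, rfl | rfl⟩) <;> decide

lemma val_mem_S4 : ∀ x a b y c d : ZMod 4, LeftType x a b → RightType y c d →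
    ReflC4 x 2 → ReflC4 y 2 → ReflC4 b d → (x.val, y.val) ∈ S4 := by
  simp only [LeftType, RightType, S4, Set.mem_insert_iff, Set.mem_singleton_iff, Prod.mk.injEq]
  rintro x a b y c d (⟨rfl, rfl, rfl | rfl⟩ | ⟨rfl, rfl, rfl⟩)
    (⟨rfl, rfl, rfl⟩ | ⟨rfl, rfl, rfl | rfl⟩) <;> decide

/-- If the D-graph of an instance retracts to the reflexive 4-cycle `H`,
then the instance admits a homomorphism to the structure `D`. -/
theorem stmt7 (α : Type) [Fintype α] (I : Inst α)
    (g : DVert I → ZMod 4) (hg : DRetr I g) :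
    ∃ f : α → ℕ, InstHom I f := by
  refine ⟨fun a => (g (ev I a)).val, fun a => val_mem_Dom _ (hg.reflC4_zero_ev a),
    fun p q h => ?_, fun p q h => ?_, fun p q h => ?_, fun p q h => ?_⟩
  · have hp : p ∈ I.L := ⟨q, Or.inl (Or.inl (Or.inl h))⟩
    have hq : q ∈ I.Rs := ⟨p, Or.inl (Or.inl (Or.inl h))⟩
    have h0 := hg.reflC4 (u := cv I ⟨q, hq⟩) (v := ev I p)
      (Or.inr <| Or.inr <| Or.inr <| Or.inr <| Or.inl ⟨p, q, h, hq, Or.inl ⟨rfl, rfl⟩⟩)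
    have h1 := hg.reflC4 (u := ev I q) (v := hv I 2)
      (Or.inr <| Or.inr <| Or.inr <| Or.inr <| Or.inl ⟨p, q, h, hq, Or.inr <| ⟨rfl, rfl⟩⟩)
    rw [hg.2] at h1
    exact val_mem_S1 _ _ _ _ _ _ (hg.leftType ⟨p, hp⟩) (hg.rightType ⟨q, hq⟩) h0 h1
  · have hp : p ∈ I.L := ⟨q, Or.inl (Or.inl (Or.inr h))⟩
    have hq : q ∈ I.Rs := ⟨p, Or.inl (Or.inl (Or.inr h))⟩
    have h0 := hg.reflC4 (u := ev I p) (v := hv I 2)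
      (Or.inr <| Or.inr <| Or.inr <| Or.inr <| Or.inr <| Or.inl ⟨p, q, h, hp, Or.inl ⟨rfl, rfl⟩⟩)
    have h1 := hg.reflC4 (u := bv I ⟨p, hp⟩) (v := ev I q)
      (Or.inr <| Or.inr <| Or.inr <| Or.inr <| Or.inr <| Or.inl ⟨p, q, h, hp, Or.inr <| ⟨rfl, rfl⟩⟩)
    rw [hg.2] at h0
    exact val_mem_S2 _ _ _ _ _ _ (hg.leftType ⟨p, hp⟩) (hg.rightType ⟨q, hq⟩) h0 h1
  · have hp : p ∈ I.L := ⟨q, Or.inl (Or.inr h)⟩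
    have hq : q ∈ I.Rs := ⟨p, Or.inl (Or.inr h)⟩
    have h0 := hg.reflC4 (u := ev I p) (v := hv I 2)
      (Or.inr <| Or.inr <| Or.inr <| Or.inr <| Or.inr <| Or.inr <| Or.inl ⟨p, q, h, hp, hq, Or.inl ⟨rfl, rfl⟩⟩)
    have h1 := hg.reflC4 (u := ev I q) (v := hv I 2)
      (Or.inr <| Or.inr <| Or.inr <| Or.inr <| Or.inr <| Or.inr <| Or.inl ⟨p, q, h, hp, hq, Or.inr <| Or.inl ⟨rfl, rfl⟩⟩)
    have h2 := hg.reflC4 (u := av I ⟨p, hp⟩) (v := cv I ⟨q, hq⟩)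
      (Or.inr <| Or.inr <| Or.inr <| Or.inr <| Or.inr <| Or.inr <| Or.inl ⟨p, q, h, hp, hq, Or.inr <| Or.inr <| ⟨rfl, rfl⟩⟩)
    rw [hg.2] at h0 h1
    exact val_mem_S3 _ _ _ _ _ _ (hg.leftType ⟨p, hp⟩) (hg.rightType ⟨q, hq⟩) h0 h1 h2
  · have hp : p ∈ I.L := ⟨q, Or.inr h⟩
    have hq : q ∈ I.Rs := ⟨p, Or.inr h⟩
    have h0 := hg.reflC4 (u := ev I p) (v := hv I 2)
      (Or.inr <| Or.inr <| Or.inr <| Or.inr <| Or.inr <| Or.inr <| Or.inr <| Or.inl ⟨p, q, h, hp, hq, Or.inl ⟨rfl, rfl⟩⟩)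
    have h1 := hg.reflC4 (u := ev I q) (v := hv I 2)
      (Or.inr <| Or.inr <| Or.inr <| Or.inr <| Or.inr <| Or.inr <| Or.inr <| Or.inl ⟨p, q, h, hp, hq, Or.inr <| Or.inl ⟨rfl, rfl⟩⟩)
    have h2 := hg.reflC4 (u := bv I ⟨p, hp⟩) (v := dv I ⟨q, hq⟩)
      (Or.inr <| Or.inr <| Or.inr <| Or.inr <| Or.inr <| Or.inr <| Or.inr <| Or.inl ⟨p, q, h, hp, hq, Or.inr <| Or.inr <| ⟨rfl, rfl⟩⟩)
    rw [hg.2] at h0 h1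
    exact val_mem_S4 _ _ _ _ _ _ (hg.leftType ⟨p, hp⟩) (hg.rightType ⟨q, hq⟩) h0 h1 h2

end Paper
end

section
/- Let A=(A;R1,R2,R3,R4) be an instance, G its D-graph, and G'' the semi-compactor of G. If G retracts to the reflexive 4-cycle H on the distinguished vertices h0,h1,h2,h3, then G'' retracts to H. -/
namespace Paper

variable {α : Type}

/-- The ordered pairs `(v,v')` of non-`H` vertices of the D-graph for which an
`x`-vertex `x_{v,v'}` is created in the semi-compactor. -/
def XPairs (I : Inst α) : Set (Core I × Core I) :=
  {pr : Core I × Core I |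
    (∃ p : ↥I.L, pr = (ca I p, ce I ↑p) ∨ pr = (ce I ↑p, cb I p) ∨
      pr = (ca I p, cb I p)) ∨
    (∃ q : ↥I.Rs, pr = (ce I ↑q, cc I q) ∨ pr = (ce I ↑q, cd I q) ∨
      pr = (cd I q, cc I q)) ∨
    (∃ p q, (p, q) ∈ I.R1 ∧ ∃ hq : q ∈ I.Rs, pr = (ce I p, cc I ⟨q, hq⟩)) ∨
    (∃ p q, (p, q) ∈ I.R2 ∧ ∃ hp : p ∈ I.L, pr = (ce I q, cb I ⟨p, hp⟩)) ∨
    (∃ p q, (p, q) ∈ I.R3 ∧ ∃ hp : p ∈ I.L, ∃ hq : q ∈ I.Rs,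
      pr = (ca I ⟨p, hp⟩, cc I ⟨q, hq⟩)) ∨
    (∃ p q, (p, q) ∈ I.R4 ∧ ∃ hp : p ∈ I.L, ∃ hq : q ∈ I.Rs,
      pr = (cd I ⟨q, hq⟩, cb I ⟨p, hp⟩))}

/-- The vertex set of the semi-compactor `G''`: the vertices of the D-graph,
vertices `u_v, w_v, y_v` for every non-`H` vertex `v`, and the `x`-vertices. -/
abbrev SVert (I : Inst α) : Type := DVert I ⊕ Core I ⊕ Core I ⊕ Core I ⊕ ↥(XPairs I)

/-- A vertex of the D-graph viewed inside the semi-compactor. -/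
def sg (I : Inst α) (v : DVert I) : SVert I := Sum.inl v
/-- The vertex `u_v`. -/
def su (I : Inst α) (v : Core I) : SVert I := Sum.inr (Sum.inl v)
/-- The vertex `w_v`. -/
def sw (I : Inst α) (v : Core I) : SVert I := Sum.inr (Sum.inr (Sum.inl v))
/-- The vertex `y_v`. -/
def sy (I : Inst α) (v : Core I) : SVert I := Sum.inr (Sum.inr (Sum.inr (Sum.inl v)))
/-- The vertex `x_{v,v'}`. -/
def sx (I : Inst α) (e : ↥(XPairs I)) : SVert I := Sum.inr (Sum.inr (Sum.inr (Sum.inr e)))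

/-- The (directed) list of edges of the semi-compactor `G''`. -/
def sBase (I : Inst α) : SVert I → SVert I → Prop := fun s t =>
  (∃ u v : DVert I, dBase I u v ∧ s = sg I u ∧ t = sg I v) ∨
  (∃ v : Core I,
    (s = su I v ∧ t = sg I (hv I 0)) ∨ (s = su I v ∧ t = sg I (hv I 1)) ∨
    (s = sy I v ∧ t = sg I (hv I 0)) ∨ (s = sy I v ∧ t = sg I (hv I 2)) ∨
    (s = sw I v ∧ t = sg I (hv I 2)) ∨ (s = sw I v ∧ t = sg I (hv I 3)) ∨
    (s = su I v ∧ t = sg I (Sum.inr v)) ∨ (s = su I v ∧ t = sw I v) ∨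
    (s = su I v ∧ t = sy I v) ∨ (s = sg I (Sum.inr v) ∧ t = sw I v) ∨
    (s = sw I v ∧ t = sy I v)) ∨
  (∃ v v' : Core I, v ≠ v' ∧
    ((s = su I v ∧ t = su I v') ∨ (s = sw I v ∧ t = sw I v'))) ∨
  (∃ e : ↥(XPairs I),
    (s = sx I e ∧ t = sg I (Sum.inr e.val.1)) ∨
    (s = sx I e ∧ t = sg I (Sum.inr e.val.2)) ∨
    (s = sx I e ∧ t = su I e.val.1) ∨
    (s = sx I e ∧ t = sw I e.val.2) ∨
    (s = sx I e ∧ t = sg I (hv I 0)) ∨ (s = sx I e ∧ t = sg I (hv I 2)))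

/-- The semi-compactor `G''` of the D-graph of `I`. -/
def SGraph (I : Inst α) : SimpleGraph (SVert I) := SimpleGraph.fromRel (sBase I)

/-- A retraction from the semi-compactor to `H`: a homomorphism fixing `h0,…,h3`. -/
def SRetr (I : Inst α) (g : SVert I → ZMod 4) : Prop :=
  IsHomC4 (SGraph I) g ∧ ∀ i : ZMod 4, g (sg I (hv I i)) = i

/-- A compaction from a simple graph `G` to the reflexive 4-cycle `H`:
a homomorphism such that every cycle edge of `H` is the image of an edge. -/
def IsCompactionC4 {V : Type} (G : SimpleGraph V) (f : V → ZMod 4) : Prop :=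
  IsHomC4 G f ∧ ∀ x y : ZMod 4, C4adj x y → ∃ u v : V, G.Adj u v ∧ f u = x ∧ f v = y

/-- Equality or adjacency in the reflexive 4-cycle. -/
def CycleRel (x y : ZMod 4) : Prop := x = y ∨ C4adj x y

instance : DecidableRel CycleRel := fun x y =>
  inferInstanceAs (Decidable (x = y ∨ y = x + 1 ∨ x = y + 1))

theorem CycleRel.symm {x y : ZMod 4} (h : CycleRel x y) : CycleRel y x := by
  revert x y; decide

theorem isHomC4_fromRel_iff {V : Type} {r : V → V → Prop} {f : V → ZMod 4} :
    IsHomC4 (SimpleGraph.fromRel r) f ↔ ∀ u v, r u v → CycleRel (f u) (f v) := by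
  constructor
  · intro h u v huv
    by_cases huv' : u = v
    · exact Or.inl (congrArg f huv')
    · exact h u v ((SimpleGraph.fromRel_adj r u v).2 ⟨huv', Or.inl huv⟩)
  · intro h u v huv
    obtain ⟨-, huv | huv⟩ := (SimpleGraph.fromRel_adj r u v).1 huv
    · exact h u v huv
    · exact (h v u huv).symm

/-- The value at `u_v` forced by the value at `v`. -/
def uVal (x : ZMod 4) : ZMod 4 := if x = 0 ∨ x = 3 then 0 else 1

/-- The value at `w_v` forced by the value at `v`. -/
def wVal (x : ZMod 4) : ZMod 4 := if x = 0 ∨ x = 3 then 3 else 2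

/-- The value at `y_v` forced by the value at `v`. -/
def yVal (x : ZMod 4) : ZMod 4 := if x = 0 ∨ x = 3 then 3 else 1

/-- A value at `x_{v,v'}` compatible with the values at `v` and `v'`. -/
def xVal (x y : ZMod 4) : ZMod 4 := if x = 3 ∨ y = 0 ∨ y = 3 then 3 else 1

theorem vertexGadget_cycleRel (x : ZMod 4) :
    CycleRel (uVal x) 0 ∧ CycleRel (uVal x) 1 ∧ CycleRel (yVal x) 0 ∧
    CycleRel (yVal x) 2 ∧ CycleRel (wVal x) 2 ∧ CycleRel (wVal x) 3 ∧
    CycleRel (uVal x) x ∧ CycleRel (uVal x) (wVal x) ∧ CycleRel (uVal x) (yVal x) ∧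
    CycleRel x (wVal x) ∧ CycleRel (wVal x) (yVal x) := by
  revert x; decide

theorem uVal_cycleRel (x y : ZMod 4) : CycleRel (uVal x) (uVal y) := by
  revert x y; decide

theorem wVal_cycleRel (x y : ZMod 4) : CycleRel (wVal x) (wVal y) := by
  revert x y; decide

/-- The `x`-gadget extends over an edge whose values do not go from `{1, 2}`
to `{0, 3}`. -/
theorem edgeGadget_cycleRel {x y : ZMod 4} (h : CycleRel x y)
    (hxy : x = 0 ∨ x = 3 ∨ y = 1 ∨ y = 2) :
    CycleRel (xVal x y) x ∧ CycleRel (xVal x y) y ∧ CycleRel (xVal x y) (uVal x) ∧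
    CycleRel (xVal x y) (wVal y) ∧ CycleRel (xVal x y) 0 ∧ CycleRel (xVal x y) 2 := by
  revert x y; decide

variable {I : Inst α} {g : DVert I → ZMod 4}

theorem DRetr.cycleRel (hg : DRetr I g) {u v : DVert I} (h : dBase I u v) :
    CycleRel (g u) (g v) :=
  isHomC4_fromRel_iff.1 hg.1 u v h

theorem DRetr.av_eq (hg : DRetr I g) (p : ↥I.L) : g (av I p) = 0 ∨ g (av I p) = 3 := by
  have h0 : CycleRel (g (av I p)) (g (hv I 0)) :=
    hg.cycleRel (.inr <| .inl ⟨p, by simp⟩)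
  have h3 : CycleRel (g (av I p)) (g (hv I 3)) :=
    hg.cycleRel (.inr <| .inl ⟨p, by simp⟩)
  rw [hg.2] at h0 h3
  generalize g (av I p) = x at *
  revert x; decide

theorem DRetr.bv_eq (hg : DRetr I g) (p : ↥I.L) : g (bv I p) = 1 ∨ g (bv I p) = 2 := by
  have h1 : CycleRel (g (bv I p)) (g (hv I 1)) :=
    hg.cycleRel (.inr <| .inl ⟨p, by simp⟩)
  have h2 : CycleRel (g (bv I p)) (g (hv I 2)) :=
    hg.cycleRel (.inr <| .inl ⟨p, by simp⟩)
  rw [hg.2] at h1 h2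
  generalize g (bv I p) = x at *
  revert x; decide

theorem DRetr.cv_eq (hg : DRetr I g) (q : ↥I.Rs) : g (cv I q) = 2 ∨ g (cv I q) = 3 := by
  have h2 : CycleRel (g (cv I q)) (g (hv I 2)) :=
    hg.cycleRel (.inr <| .inr <| .inl ⟨q, by simp⟩)
  have h3 : CycleRel (g (cv I q)) (g (hv I 3)) :=
    hg.cycleRel (.inr <| .inr <| .inl ⟨q, by simp⟩)
  rw [hg.2] at h2 h3
  generalize g (cv I q) = x at *
  revert x; decide

theorem DRetr.dv_eq (hg : DRetr I g) (q : ↥I.Rs) : g (dv I q) = 0 ∨ g (dv I q) = 1 := by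
  have h0 : CycleRel (g (dv I q)) (g (hv I 0)) :=
    hg.cycleRel (.inr <| .inr <| .inl ⟨q, by simp⟩)
  have h1 : CycleRel (g (dv I q)) (g (hv I 1)) :=
    hg.cycleRel (.inr <| .inr <| .inl ⟨q, by simp⟩)
  rw [hg.2] at h0 h1
  generalize g (dv I q) = x at *
  revert x; decide

theorem DRetr.ev_ne_two (hg : DRetr I g) (a : α) : g (ev I a) ≠ 2 := by
  have h : CycleRel (g (hv I 0)) (g (ev I a)) :=
    hg.cycleRel (.inr <| .inr <| .inr <| .inl ⟨a, rfl, rfl⟩)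
  rw [hg.2] at h
  generalize g (ev I a) = x at *
  revert x; decide

/-- Adjacent values `x` at an element and `y` at a `c`-vertex satisfy the
hypothesis of `edgeGadget_cycleRel`. -/
theorem eq_of_cycleRel_of_cv {x y : ZMod 4} (hx : x ≠ 2) (hy : y = 2 ∨ y = 3)
    (h : CycleRel x y) : x = 0 ∨ x = 3 ∨ y = 1 ∨ y = 2 := by
  revert x y; decide

/-- Values `x`, `y`, `z` of a triangle formed by an element, its `c`-vertex
and its `d`-vertex: both pairs `(x, z)` and `(z, y)` satisfy the hypothesis of
`edgeGadget_cycleRel`. -/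
theorem eq_of_cycleRel_triangle {x y z : ZMod 4} (hx : x ≠ 2) (hy : y = 2 ∨ y = 3)
    (hz : z = 0 ∨ z = 1) (hyx : CycleRel y x) (hzx : CycleRel z x) (hyz : CycleRel y z) :
    (x = 0 ∨ x = 3 ∨ z = 1 ∨ z = 2) ∧ (z = 0 ∨ z = 3 ∨ y = 1 ∨ y = 2) := by
  revert x y z; decide

theorem DRetr.xPair (hg : DRetr I g) {e : Core I × Core I} (he : e ∈ XPairs I) :
    CycleRel (g (Sum.inr e.1)) (g (Sum.inr e.2)) ∧
      (g (Sum.inr e.1) = 0 ∨ g (Sum.inr e.1) = 3 ∨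
        g (Sum.inr e.2) = 1 ∨ g (Sum.inr e.2) = 2) := by
  have left : ∀ {x y : ZMod 4}, x = 0 ∨ x = 3 → x = 0 ∨ x = 3 ∨ y = 1 ∨ y = 2 := by tauto
  have right : ∀ {x y : ZMod 4}, y = 1 ∨ y = 2 → x = 0 ∨ x = 3 ∨ y = 1 ∨ y = 2 := by tauto
  obtain ⟨p, rfl | rfl | rfl⟩ | ⟨q, hq⟩ | ⟨p, q, h, hq, rfl⟩ | ⟨p, q, h, hp, rfl⟩ |
    ⟨p, q, h, hp, hq, rfl⟩ | ⟨p, q, h, hp, hq, rfl⟩ := he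
  · exact ⟨hg.cycleRel (.inr <| .inl ⟨p, .inl ⟨rfl, rfl⟩⟩), left (hg.av_eq p)⟩
  · exact ⟨(hg.cycleRel (.inr <| .inl ⟨p, .inr <| .inl ⟨rfl, rfl⟩⟩)).symm,
      right (hg.bv_eq p)⟩
  · exact ⟨hg.cycleRel (.inr <| .inl ⟨p, .inr <| .inr <| .inl ⟨rfl, rfl⟩⟩),
      left (hg.av_eq p)⟩
  · have hce : CycleRel (g (cv I q)) (g (ev I q)) :=
      hg.cycleRel (.inr <| .inr <| .inl ⟨q, .inl ⟨rfl, rfl⟩⟩)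
    have hde : CycleRel (g (dv I q)) (g (ev I q)) :=
      hg.cycleRel (.inr <| .inr <| .inl ⟨q, .inr <| .inl ⟨rfl, rfl⟩⟩)
    have hcd : CycleRel (g (cv I q)) (g (dv I q)) :=
      hg.cycleRel (.inr <| .inr <| .inl ⟨q, .inr <| .inr <| .inl ⟨rfl, rfl⟩⟩)
    have triangle := eq_of_cycleRel_triangle (hg.ev_ne_two q) (hg.cv_eq q) (hg.dv_eq q)
      hce hde hcd
    obtain rfl | rfl | rfl := hq
    · exact ⟨hce.symm, eq_of_cycleRel_of_cv (hg.ev_ne_two q) (hg.cv_eq q) hce.symm⟩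
    · exact ⟨hde.symm, triangle.1⟩
    · exact ⟨hcd.symm, triangle.2⟩
  · have hce : CycleRel (g (cv I ⟨q, hq⟩)) (g (ev I p)) :=
      hg.cycleRel (.inr <| .inr <| .inr <| .inr <| .inl ⟨p, q, h, hq, .inl ⟨rfl, rfl⟩⟩)
    exact ⟨hce.symm, eq_of_cycleRel_of_cv (hg.ev_ne_two p) (hg.cv_eq _) hce.symm⟩
  · exact ⟨(hg.cycleRel (.inr <| .inr <| .inr <| .inr <| .inr <| .inl
      ⟨p, q, h, hp, .inr ⟨rfl, rfl⟩⟩)).symm, right (hg.bv_eq _)⟩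
  · exact ⟨hg.cycleRel (.inr <| .inr <| .inr <| .inr <| .inr <| .inr <| .inl
      ⟨p, q, h, hp, hq, .inr <| .inr ⟨rfl, rfl⟩⟩), left (hg.av_eq _)⟩
  · exact ⟨(hg.cycleRel (.inr <| .inr <| .inr <| .inr <| .inr <| .inr <| .inr <| .inl
      ⟨p, q, h, hp, hq, .inr <| .inr ⟨rfl, rfl⟩⟩)).symm, right (hg.bv_eq _)⟩

/-- The extension of a map on the D-graph to the semi-compactor. -/
def semiCompactorExtend (g : DVert I → ZMod 4) : SVert I → ZMod 4 :=
  Sum.elim g <| Sum.elim (fun v => uVal (g (Sum.inr v))) <|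
    Sum.elim (fun v => wVal (g (Sum.inr v))) <| Sum.elim (fun v => yVal (g (Sum.inr v)))
      (fun e => xVal (g (Sum.inr e.val.1)) (g (Sum.inr e.val.2)))

theorem DRetr.semiCompactorExtend (hg : DRetr I g) : SRetr I (semiCompactorExtend g) := by
  refine ⟨isHomC4_fromRel_iff.2 ?_, hg.2⟩
  rintro s t (⟨u, v, huv, rfl, rfl⟩ | ⟨v, hv⟩ | ⟨v, v', -, ⟨rfl, rfl⟩ | ⟨rfl, rfl⟩⟩ | ⟨e, he⟩)
  · exact hg.cycleRel huv
  · have hgadget := vertexGadget_cycleRel (g (Sum.inr v))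
    rcases hv with ⟨rfl, rfl⟩ | ⟨rfl, rfl⟩ | ⟨rfl, rfl⟩ | ⟨rfl, rfl⟩ | ⟨rfl, rfl⟩ | ⟨rfl, rfl⟩ |
      ⟨rfl, rfl⟩ | ⟨rfl, rfl⟩ | ⟨rfl, rfl⟩ | ⟨rfl, rfl⟩ | ⟨rfl, rfl⟩ <;>
    simp [Paper.semiCompactorExtend, su, sw, sy, sg, hg.2, hgadget]
  · exact uVal_cycleRel _ _
  · exact wVal_cycleRel _ _
  · obtain ⟨hadj, hval⟩ := hg.xPair e.2
    have hgadget := edgeGadget_cycleRel hadj hval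
    rcases he with ⟨rfl, rfl⟩ | ⟨rfl, rfl⟩ | ⟨rfl, rfl⟩ | ⟨rfl, rfl⟩ | ⟨rfl, rfl⟩ | ⟨rfl, rfl⟩ <;>
    simp [Paper.semiCompactorExtend, sx, su, sw, sg, hg.2, hgadget]

/-- If the D-graph retracts to the reflexive 4-cycle `H`, then so does its
semi-compactor. -/
theorem stmt10 (α : Type) [Fintype α] (I : Inst α)
    (g : DVert I → ZMod 4) (hg : DRetr I g) :
    ∃ g' : SVert I → ZMod 4, SRetr I g' := by
  exact ⟨semiCompactorExtend g, hg.semiCompactorExtend⟩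

end Paper
end
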